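/- Let N > 1, c ≥ 2, and k ∈ {1,…,c} be integers. If both Λ_{c−1,k−1}^N and Λ_{c,k}^N are Gray codes, then Λ_{c,k−1}^N is a Gray code. -/

import Mathlib

/-- `T(x)`: the list of pairs `(x_1,1), (x_2,2), …, (x_c,c)`, where pairs are
compared lexicographically (first by value, then by index). -/
def Tlist {c : ℕ} (x : Fin c → ℕ) : List (ℕ ×ₗ ℕ) :=
  List.ofFn fun i => toLex (x i, i.1 + 1)

/-- `T'(x)`: the list `T(x)` sorted lexicographically. -/
def Tsorted {c : ℕ} (x : Fin c → ℕ) : List (ℕ ×ₗ ℕ) :=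
  List.insertionSort (· ≤ ·) (Tlist x)

/-- Auxiliary comparison for the alternating lexicographic order.  The Boolean
argument records whether the current (1-based) position is odd; at the first
position where the two lists differ, the comparison is by `<` at odd positions
and by the reversed `<` at even positions. -/
def altB {α : Type*} [LinearOrder α] : Bool → List α → List α → Bool
  | _, [], _ => false
  | _, _ :: _, [] => false
  | oddPos, a :: as, b :: bs =>
      if a = b then altB (!oddPos) as bs
      else if oddPos then decide (a < b) else decide (b < a)

/-- The alternating lexicographic order `<_ALT`: if `j` is the first position where
the lists differ (positions numbered from 1), then `a <_ALT b` iff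
`(a_j < b_j) XOR (j is even)`. -/
def altLt {α : Type*} [LinearOrder α] (a b : List α) : Prop := altB true a b = true

/-- The Vortex order: `x <_VORTEX y` iff `T'(x) <_ALT T'(y)`. -/
def vortexLt {c : ℕ} (x y : Fin c → ℕ) : Prop := altLt (Tsorted x) (Tsorted y)

/-- The non-strict Vortex order. -/
def vortexLe {c : ℕ} (x y : Fin c → ℕ) : Prop := vortexLt x y ∨ x = y

instance {c : ℕ} : DecidableRel (@vortexLe c) := fun x y => by
  unfold vortexLe vortexLt altLt; infer_instance

/-- `VORTEX(N_1,…,N_c)`: the list of all tuples of `{1,…,N_1} × ⋯ × {1,…,N_c}`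
sorted in increasing Vortex order. -/
noncomputable def vortexList {c : ℕ} (Ns : Fin c → ℕ) : List (Fin c → ℕ) :=
  List.insertionSort vortexLe (Fintype.piFinset fun i => Finset.Icc 1 (Ns i)).toList

/-- `Λ_{c,k}^N`: `VORTEX(N,…,N,N-1,…,N-1)` with `c-k` copies of `N` followed by
`k` copies of `N-1`. -/
noncomputable def Lam (c k N : ℕ) : List (Fin c → ℕ) :=
  vortexList fun i => if i.1 < c - k then N else N - 1

/-- A list of tuples is a Gray code if every pair of consecutive tuples has
Hamming distance exactly 1. -/
def IsGrayCode {c : ℕ} (l : List (Fin c → ℕ)) : Prop :=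
  l.Chain' fun x y => hammingDist x y = 1

/-- The lists of pairs with strictly increasing entries above `L`, whose indices are exactly the
elements of `S` and whose value at the index `i` is at most `M i`. -/
inductive IsVortexTail (M : ℕ → ℕ) : Finset ℕ → ℕ ×ₗ ℕ → List (ℕ ×ₗ ℕ) → Prop
  | nil (L) : IsVortexTail M ∅ L []
  | cons {S L p l} (hS : (ofLex p).2 ∈ S) (hL : L < p) (hM : (ofLex p).1 ≤ M (ofLex p).2)
      (hl : IsVortexTail M (S.erase (ofLex p).2) p l) : IsVortexTail M S L (p :: l)

section altB

variable {α : Type*} [LinearOrder α]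

theorem altB_not (b : Bool) (l l' : List α) : altB (!b) l l' = altB b l' l := by
  induction l generalizing b l' with
  | nil => cases l' <;> simp [altB]
  | cons p t ih =>
    cases l' with
    | nil => simp [altB]
    | cons q t' =>
      by_cases h : p = q
      · subst h; simp only [altB, if_true]; exact ih _ _
      · cases b <;> simp [altB, h, Ne.symm h]

theorem altB_cons_self (b : Bool) (p : α) (l l' : List α) :
    altB b (p :: l) (p :: l') = altB (!b) l l' := by
  simp [altB]

theorem altB_cons_of_ne {p q : α} (b : Bool) (h : p ≠ q) (l l' : List α) :
    altB b (p :: l) (q :: l') = if b then decide (p < q) else decide (q < p) := by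
  simp [altB, h]

theorem altB_asymm {b : Bool} {l l' : List α} (h : altB b l l' = true) :
    altB b l' l = false := by
  induction l generalizing b l' with
  | nil => cases l' <;> simp [altB] at h
  | cons p t ih =>
    cases l' with
    | nil => simp [altB] at h
    | cons q t' =>
      by_cases hpq : p = q
      · subst hpq
        rw [altB_cons_self] at h ⊢
        exact ih h
      · rw [altB_cons_of_ne _ hpq] at h
        rw [altB_cons_of_ne _ (Ne.symm hpq)]
        cases b <;> simp at h ⊢ <;> exact h.le

theorem altB_trans {b : Bool} {l₁ l₂ l₃ : List α} (h : altB b l₁ l₂ = true)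
    (h' : altB b l₂ l₃ = true) : altB b l₁ l₃ = true := by
  induction l₁ generalizing b l₂ l₃ with
  | nil => cases l₂ <;> simp [altB] at h
  | cons p t ih =>
    obtain _ | ⟨q, t'⟩ := l₂
    · simp [altB] at h
    obtain _ | ⟨r, t''⟩ := l₃
    · simp [altB] at h'
    by_cases hpq : p = q
    · subst hpq
      by_cases hpr : p = r
      · subst hpr
        rw [altB_cons_self] at h h' ⊢
        exact ih h h'
      · rw [altB_cons_of_ne _ hpr] at h' ⊢
        exact h'
    · by_cases hqr : q = r
      · subst hqr
        rw [altB_cons_of_ne _ hpq] at h ⊢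
        exact h
      · rw [altB_cons_of_ne _ hpq] at h
        rw [altB_cons_of_ne _ hqr] at h'
        cases b
        · simp only [Bool.false_eq_true, if_false, decide_eq_true_eq] at h h'
          rw [altB_cons_of_ne _ (h'.trans h).ne']
          simpa using h'.trans h
        · simp only [if_true, decide_eq_true_eq] at h h'
          rw [altB_cons_of_ne _ (h.trans h').ne]
          simpa using h.trans h'

theorem altB_total (b : Bool) {l l' : List α} (hlen : l.length = l'.length) (hne : l ≠ l') :
    altB b l l' = true ∨ altB b l' l = true := by
  induction l generalizing b l' with
  | nil => cases l' <;> simp_all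
  | cons p t ih =>
    obtain _ | ⟨q, t'⟩ := l'
    · simp at hlen
    by_cases hpq : p = q
    · subst hpq
      simp only [altB_cons_self]
      exact ih _ (by simpa using hlen) (by simpa using hne)
    · rw [altB_cons_of_ne _ hpq, altB_cons_of_ne _ (Ne.symm hpq)]
      cases b <;> simp [lt_or_gt_of_ne hpq, lt_or_gt_of_ne (Ne.symm hpq)]

end altB

namespace IsVortexTail

variable {M : ℕ → ℕ} {S : Finset ℕ} {L : ℕ ×ₗ ℕ} {l : List (ℕ ×ₗ ℕ)}

theorem toLex_le_top {p : ℕ ×ₗ ℕ} (h : (ofLex p).1 ≤ M (ofLex p).2) :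
    p ≤ toLex (M (ofLex p).2, (ofLex p).2) := by
  rw [Prod.Lex.le_iff]
  simp only [ofLex_toLex]
  omega

theorem of_cons {p : ℕ ×ₗ ℕ} (h : IsVortexTail M S L (p :: l)) :
    (ofLex p).2 ∈ S ∧ L < p ∧ (ofLex p).1 ≤ M (ofLex p).2 ∧
      IsVortexTail M (S.erase (ofLex p).2) p l := by
  cases h with
  | cons hS hL hM hl => exact ⟨hS, hL, hM, hl⟩

theorem mem_spec (h : IsVortexTail M S L l) {p : ℕ ×ₗ ℕ} (hp : p ∈ l) :
    (ofLex p).2 ∈ S ∧ L < p ∧ (ofLex p).1 ≤ M (ofLex p).2 := by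
  induction h with
  | nil => simp at hp
  | cons hS hL hM _ ih =>
    obtain rfl | hp := List.mem_cons.1 hp
    · exact ⟨hS, hL, hM⟩
    · obtain ⟨h1, h2, h3⟩ := ih hp
      exact ⟨Finset.mem_of_mem_erase h1, hL.trans h2, h3⟩

theorem exists_mem (h : IsVortexTail M S L l) {i : ℕ} (hi : i ∈ S) :
    ∃ p ∈ l, (ofLex p).2 = i := by
  induction h with
  | nil => simp at hi
  | @cons S L p l hS hL hM _ ih =>
    by_cases hip : i = (ofLex p).2
    · exact ⟨p, by simp, hip.symm⟩
    · obtain ⟨q, hq, hqi⟩ := ih (Finset.mem_erase.2 ⟨hip, hi⟩)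
      exact ⟨q, List.mem_cons_of_mem _ hq, hqi⟩

theorem eq_of_mem (h : IsVortexTail M S L l) {p q : ℕ ×ₗ ℕ} (hp : p ∈ l) (hq : q ∈ l)
    (hpq : (ofLex p).2 = (ofLex q).2) : p = q := by
  induction h with
  | nil => simp at hp
  | cons hS hL hM hl ih =>
    rcases List.mem_cons.1 hp with rfl | hp' <;> rcases List.mem_cons.1 hq with rfl | hq'
    · rfl
    · exact absurd hpq.symm (Finset.ne_of_mem_erase (hl.mem_spec hq').1)
    · exact absurd hpq (Finset.ne_of_mem_erase (hl.mem_spec hp').1)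
    · exact ih hp' hq'

theorem lt_top (h : IsVortexTail M S L l) {i : ℕ} (hi : i ∈ S) : L < toLex (M i, i) := by
  obtain ⟨p, hp, rfl⟩ := h.exists_mem hi
  obtain ⟨-, h2, h3⟩ := h.mem_spec hp
  exact h2.trans_le (toLex_le_top h3)

theorem pairwise_lt (h : IsVortexTail M S L l) : l.Pairwise (· < ·) := by
  induction h with
  | nil => exact List.Pairwise.nil
  | cons hS hL hM hl ih => exact List.Pairwise.cons (fun q hq => (hl.mem_spec hq).2.1) ih

theorem exists_of_lt_top (S : Finset ℕ) (L : ℕ ×ₗ ℕ) (h : ∀ i ∈ S, L < toLex (M i, i)) :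
    ∃ l, IsVortexTail M S L l := by
  induction S using Finset.strongInduction generalizing L with
  | H S ih =>
    obtain rfl | hne := S.eq_empty_or_nonempty
    · exact ⟨[], .nil L⟩
    · obtain ⟨a, ha, hmin⟩ := S.exists_min_image (fun i => toLex (M i, i)) hne
      obtain ⟨t, ht⟩ := ih (S.erase a) (Finset.erase_ssubset ha) (toLex (M a, a)) fun i hi =>
        lt_of_le_of_ne (hmin i (Finset.mem_of_mem_erase hi)) fun h => by
          simp only [EmbeddingLike.apply_eq_iff_eq, Prod.mk.injEq] at h
          exact Finset.ne_of_mem_erase hi h.2.symm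
      exact ⟨_ :: t, .cons (p := toLex (M a, a)) ha (h a ha) le_rfl ht⟩

/-- If the head of `l` is as large as possible, then all values of `l` are maximal. -/
theorem eq_top_of_max (hM : ∀ i j v, v ≤ M j → toLex (M i, i) < toLex (v, j) → v = M j)
    (h : IsVortexTail M S L l) (hmax : ∀ z, IsVortexTail M S L z → altB true l z = false) :
    ∀ p ∈ l, (ofLex p).1 = M (ofLex p).2 := by
  cases h with
  | nil => simp
  | @cons _ _ p t hS hL hpM ht =>
    have h : IsVortexTail M S L (p :: t) := .cons hS hL hpM ht
    obtain ⟨a, ha, hmin⟩ := S.exists_min_image (fun i => toLex (M i, i)) ⟨_, hS⟩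
    obtain ⟨w, hw⟩ := exists_of_lt_top (M := M) (S.erase a) (toLex (M a, a)) fun i hi =>
      lt_of_le_of_ne (hmin i (Finset.mem_of_mem_erase hi)) fun h => by
        simp only [EmbeddingLike.apply_eq_iff_eq, Prod.mk.injEq] at h
        exact Finset.ne_of_mem_erase hi h.2.symm
    have hle : p ≤ toLex (M a, a) := by
      obtain ⟨q, hq, rfl⟩ := h.exists_mem ha
      refine le_trans ?_ (toLex_le_top (h.mem_spec hq).2.2)
      obtain rfl | hq := List.mem_cons.1 hq
      · exact le_rfl
      · exact (ht.mem_spec hq).2.1.le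
    have hp : p = toLex (M a, a) := by
      by_contra hne
      have := hmax _ (.cons (p := toLex (M a, a)) ha (h.lt_top ha) le_rfl hw)
      rw [altB_cons_of_ne _ hne] at this
      simp only [if_true, decide_eq_false_iff_not] at this
      exact this (lt_of_le_of_ne hle hne)
    intro q hq
    obtain rfl | hq := List.mem_cons.1 hq
    · rw [hp]; rfl
    · have hq' := ht.mem_spec hq
      exact hM a (ofLex q).2 (ofLex q).1 hq'.2.2 (by simpa [← hp] using hq'.2.1)

theorem mem_iff_of_eq_top (h : IsVortexTail M S L l)
    (htop : ∀ p ∈ l, (ofLex p).1 = M (ofLex p).2) (p : ℕ ×ₗ ℕ) :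
    p ∈ l ↔ (ofLex p).2 ∈ S ∧ (ofLex p).1 = M (ofLex p).2 := by
  refine ⟨fun hp => ⟨(h.mem_spec hp).1, htop p hp⟩, fun ⟨h1, h2⟩ => ?_⟩
  obtain ⟨q, hq, hqp⟩ := h.exists_mem h1
  have hqv := htop q hq
  rw [hqp, ← h2] at hqv
  have : q = p := ofLex.injective (Prod.ext hqv hqp)
  exact this ▸ hq

/-- Two lists which are consecutive at their heads differ in a single index. -/
theorem agree_of_head_lt
    (hM : ∀ i j v, v ≤ M j → toLex (M i, i) < toLex (v, j) → v = M j)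
    {A B : ℕ ×ₗ ℕ} {t t' : List (ℕ ×ₗ ℕ)} (hAB : A < B)
    (hA : IsVortexTail M S L (A :: t)) (hB : IsVortexTail M S L (B :: t'))
    (hgap : ∀ C w, A < C → C < B → ¬ IsVortexTail M S L (C :: w))
    (ht : ∀ z, IsVortexTail M (S.erase (ofLex A).2) A z → altB false t z = false)
    (ht' : ∀ z, IsVortexTail M (S.erase (ofLex B).2) B z → altB true t' z = false) :
    ∃ i, ∀ p : ℕ ×ₗ ℕ, (ofLex p).2 ≠ i → (p ∈ A :: t ↔ p ∈ B :: t') := by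
  obtain _ | ⟨hAS, hLA, hAM, htail⟩ := hA
  obtain _ | ⟨hBS, hLB, hBM, htail'⟩ := hB
  have htop' := htail'.eq_top_of_max hM ht'
  have hlt : ∀ i ∈ S, ∀ C < B, C < toLex (M i, i) := fun i hi C hC => by
    by_cases hiB : i = (ofLex B).2
    · exact hiB ▸ hC.trans_le (toLex_le_top hBM)
    · exact hC.trans (htail'.lt_top (Finset.mem_erase.2 ⟨hiB, hi⟩))
  have hno : ∀ C : ℕ ×ₗ ℕ, (ofLex C).2 ∈ S → A < C → C < B → False := fun C hCS hAC hCB => by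
    obtain ⟨w, hw⟩ := exists_of_lt_top (M := M) (S.erase (ofLex C).2) C fun i hi =>
      hlt i (Finset.mem_of_mem_erase hi) C hCB
    refine hgap C w hAC hCB (.cons hCS (hLA.trans hAC) ?_ hw)
    have := hlt _ hCS C hCB
    rw [Prod.Lex.lt_iff] at this
    simp only [ofLex_toLex] at this
    omega
  by_cases hαβ : (ofLex A).2 = (ofLex B).2
  · have hS : S.erase (ofLex A).2 = ∅ := by
      rw [Finset.eq_empty_iff_forall_notMem]
      intro δ hδ
      obtain ⟨hne, hδS⟩ := Finset.mem_erase.1 hδ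
      rw [Prod.Lex.lt_iff] at hAB
      rcases lt_or_gt_of_ne hne with h | h
      · refine hno (toLex ((ofLex A).1 + 1, δ)) hδS ?_ ?_ <;> rw [Prod.Lex.lt_iff] <;>
          simp only [ofLex_toLex] <;> omega
      · refine hno (toLex ((ofLex A).1, δ)) hδS (Prod.Lex.lt_iff.2 (.inr ⟨rfl, h⟩)) ?_
        rw [Prod.Lex.lt_iff]
        simp only [ofLex_toLex]
        omega
    refine ⟨(ofLex A).2, fun p hp => ?_⟩
    have hpt : p ∉ t := fun h => by simpa [hS] using (htail.mem_spec h).1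
    have hpt' : p ∉ t' := fun h => by simpa [← hαβ, hS] using (htail'.mem_spec h).1
    have hpA : p ≠ A := fun h => hp (h ▸ rfl)
    have hpB : p ≠ B := fun h => hp (h ▸ hαβ.symm)
    simp [hpt, hpt', hpA, hpB]
  · have hβ : (ofLex B).2 ∈ S.erase (ofLex A).2 := Finset.mem_erase.2 ⟨Ne.symm hαβ, hBS⟩
    obtain _ | ⟨μ, u⟩ := t
    · simpa using htail.exists_mem hβ
    obtain ⟨hμS, hAμ, hμM, hu⟩ := htail.of_cons
    have hB' : ∀ z, IsVortexTail M ((S.erase (ofLex A).2).erase (ofLex B).2) B z →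
        IsVortexTail M (S.erase (ofLex A).2) A (B :: z) := fun z hz => .cons hβ hAB hBM hz
    obtain ⟨w, hw⟩ := exists_of_lt_top (M := M) ((S.erase (ofLex A).2).erase (ofLex B).2) B
      fun i hi => htail'.lt_top (by simp_all)
    have hμB : μ = B := by
      by_contra hne
      have := ht _ (hB' w hw)
      rw [altB_cons_of_ne _ hne] at this
      simp only [Bool.false_eq_true, if_false, decide_eq_false_iff_not, not_lt] at this
      exact hno μ (Finset.mem_of_mem_erase hμS) hAμ (lt_of_le_of_ne this hne)
    subst hμB
    have hutop := hu.eq_top_of_max hM fun z hz => by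
      have := ht _ (hB' z hz)
      rwa [altB_cons_self] at this
    refine ⟨(ofLex A).2, fun p hp => ?_⟩
    have hpA : p ≠ A := fun h => hp (h ▸ rfl)
    simp only [List.mem_cons, hpA, false_or, hu.mem_iff_of_eq_top hutop,
      htail'.mem_iff_of_eq_top htop', Finset.mem_erase, ne_eq, hp, not_false_eq_true, true_and]

/-- Two consecutive lists in the alternating lexicographic order differ in a single index. -/
theorem agree_of_consecutive
    (hM : ∀ i j v, v ≤ M j → toLex (M i, i) < toLex (v, j) → v = M j)
    {b : Bool} {l l' : List (ℕ ×ₗ ℕ)} (hl : IsVortexTail M S L l) (hl' : IsVortexTail M S L l')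
    (hlt : altB b l l' = true)
    (hgap : ∀ z, IsVortexTail M S L z → altB b l z = true → altB b z l' = false) :
    ∃ i, ∀ p : ℕ ×ₗ ℕ, (ofLex p).2 ≠ i → (p ∈ l ↔ p ∈ l') := by
  induction hl generalizing b l' with
  | nil => cases l' <;> simp [altB] at hlt
  | @cons S L p t hS hL hpM ht ih =>
    have hl : IsVortexTail M S L (p :: t) := .cons hS hL hpM ht
    obtain _ | @⟨_, _, q, t', hS', hL', hqM, ht'⟩ := hl'
    · simp [altB] at hlt
    have hl' : IsVortexTail M S L (q :: t') := .cons hS' hL' hqM ht'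
    by_cases hpq : p = q
    · subst hpq
      rw [altB_cons_self] at hlt
      obtain ⟨i, hi⟩ := ih ht' hlt fun z hz h => by
        have := hgap (p :: z) (.cons hS hL hpM hz)
        simp only [altB_cons_self] at this
        exact this h
      exact ⟨i, fun r hr => by simp only [List.mem_cons, hi r hr]⟩
    rw [altB_cons_of_ne _ hpq] at hlt
    have hfst : ∀ z, IsVortexTail M (S.erase (ofLex p).2) p z → altB (!b) t z = false := by
      intro z hz
      by_contra h
      have := hgap (p :: z) (.cons hS hL hpM hz) (by simpa [altB_cons_self] using h)
      rw [altB_cons_of_ne _ hpq, hlt] at this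
      simp at this
    have hsnd : ∀ z, IsVortexTail M (S.erase (ofLex q).2) q z → altB b t' z = false := by
      intro z hz
      have := hgap (q :: z) (.cons hS' hL' hqM hz) (by rw [altB_cons_of_ne _ hpq, hlt])
      rwa [altB_cons_self, altB_not] at this
    cases b
    · simp only [Bool.false_eq_true, if_false, decide_eq_true_eq] at hlt
      obtain ⟨i, hi⟩ := agree_of_head_lt hM hlt hl' hl (fun C w hC hC' hCw => by
        have := hgap _ hCw
        rw [altB_cons_of_ne _ hC'.ne', altB_cons_of_ne _ hC.ne'] at this
        simp [hC, hC'] at this) hsnd hfst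
      exact ⟨i, fun r hr => (hi r hr).symm⟩
    · simp only [if_true, decide_eq_true_eq] at hlt
      exact agree_of_head_lt hM hlt hl hl' (fun C w hC hC' hCw => by
        have := hgap _ hCw
        rw [altB_cons_of_ne _ hC.ne, altB_cons_of_ne _ hC'.ne] at this
        simp [hC, hC'] at this) hfst hsnd

theorem of_pairwise (hlt : l.Pairwise (· < ·)) (hinj : (l.map fun p => (ofLex p).2).Nodup)
    (hS : ∀ i, i ∈ S ↔ ∃ p ∈ l, (ofLex p).2 = i)
    (hl : ∀ p ∈ l, L < p ∧ (ofLex p).1 ≤ M (ofLex p).2) : IsVortexTail M S L l := by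
  induction l generalizing S L with
  | nil =>
    obtain rfl : S = ∅ := by ext; simp [hS]
    exact .nil L
  | cons p t ih =>
    rw [List.pairwise_cons] at hlt
    rw [List.map_cons, List.nodup_cons] at hinj
    refine .cons ((hS _).2 ⟨p, by simp, rfl⟩) (hl p (by simp)).1 (hl p (by simp)).2
      (ih hlt.2 hinj.2 (fun i => ?_) fun q hq => ⟨hlt.1 q hq, (hl q (by simp [hq])).2⟩)
    rw [Finset.mem_erase, hS]
    constructor
    · rintro ⟨hne, q, hq, rfl⟩
      obtain rfl | hq := List.mem_cons.1 hq
      · exact absurd rfl hne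
      · exact ⟨q, hq, rfl⟩
    · rintro ⟨q, hq, rfl⟩
      exact ⟨fun h => hinj.1 (h ▸ List.mem_map.2 ⟨q, hq, rfl⟩), q, by simp [hq], rfl⟩

end IsVortexTail

section Tsorted

variable {c : ℕ}

theorem mem_Tsorted {x : Fin c → ℕ} {p : ℕ ×ₗ ℕ} :
    p ∈ Tsorted x ↔ ∃ i, toLex (x i, i.1 + 1) = p := by
  simp [Tsorted, Tlist, List.mem_ofFn]

theorem length_Tsorted (x : Fin c → ℕ) : (Tsorted x).length = c := by
  simp [Tsorted, Tlist]

theorem nodup_map_snd_Tsorted (x : Fin c → ℕ) :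
    ((Tsorted x).map fun p => (ofLex p).2).Nodup := by
  refine (((List.perm_insertionSort _ _).map _).nodup_iff).2 ?_
  rw [Tlist, List.map_ofFn, List.nodup_ofFn]
  intro i j h
  simpa [Fin.ext_iff] using h

theorem pairwise_lt_Tsorted (x : Fin c → ℕ) : (Tsorted x).Pairwise (· < ·) :=
  ((List.pairwise_insertionSort (· ≤ ·) _).and (nodup_map_snd_Tsorted x).of_map).imp
    fun h => lt_of_le_of_ne h.1 h.2

theorem Tsorted_injective : Function.Injective (Tsorted (c := c)) := by
  intro x y h
  funext i
  have hi : toLex (x i, i.1 + 1) ∈ Tsorted y := h ▸ mem_Tsorted.2 ⟨i, rfl⟩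
  obtain ⟨j, hj⟩ := mem_Tsorted.1 hi
  simp only [EmbeddingLike.apply_eq_iff_eq, Prod.mk.injEq, add_left_inj, Fin.val_inj] at hj
  obtain ⟨h1, rfl⟩ := hj
  exact h1.symm

variable {M : ℕ → ℕ}

theorem isVortexTail_Tsorted {x : Fin c → ℕ} (hx : ∀ i, x i ∈ Finset.Icc 1 (M (i.1 + 1))) :
    IsVortexTail M (Finset.Icc 1 c) (toLex (1, 0)) (Tsorted x) := by
  refine .of_pairwise (pairwise_lt_Tsorted x) (nodup_map_snd_Tsorted x) (fun j => ?_) ?_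
  · constructor
    · intro hj
      rw [Finset.mem_Icc] at hj
      exact ⟨_, mem_Tsorted.2 ⟨⟨j - 1, by omega⟩, rfl⟩, by simp only [ofLex_toLex]; omega⟩
    · rintro ⟨p, hp, rfl⟩
      obtain ⟨i, rfl⟩ := mem_Tsorted.1 hp
      simp only [ofLex_toLex, Finset.mem_Icc]
      omega
  · intro p hp
    obtain ⟨i, rfl⟩ := mem_Tsorted.1 hp
    have := Finset.mem_Icc.1 (hx i)
    rw [Prod.Lex.lt_iff]
    simp only [ofLex_toLex]
    omega

theorem IsVortexTail.exists_Tsorted_eq {l : List (ℕ ×ₗ ℕ)}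
    (h : IsVortexTail M (Finset.Icc 1 c) (toLex (1, 0)) l) :
    ∃ x : Fin c → ℕ, (∀ i, x i ∈ Finset.Icc 1 (M (i.1 + 1))) ∧ Tsorted x = l := by
  have hex : ∀ i : Fin c, ∃ p ∈ l, (ofLex p).2 = i.1 + 1 := fun i =>
    h.exists_mem (Finset.mem_Icc.2 (by omega))
  choose f hfl hf using hex
  have hfeq : ∀ i, toLex ((ofLex (f i)).1, i.1 + 1) = f i := fun i =>
    ofLex.injective (Prod.ext rfl (hf i).symm)
  refine ⟨fun i => (ofLex (f i)).1, fun i => ?_, ?_⟩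
  · obtain ⟨-, h2, h3⟩ := h.mem_spec (hfl i)
    rw [hf] at h3
    rw [Prod.Lex.lt_iff] at h2
    simp only [ofLex_toLex] at h2
    simp only [Finset.mem_Icc]
    omega
  · refine List.Perm.eq_of_pairwise' (r := (· ≤ ·)) ((pairwise_lt_Tsorted _).imp le_of_lt)
      (h.pairwise_lt.imp le_of_lt) ((List.perm_ext_iff_of_nodup ((pairwise_lt_Tsorted _).imp ne_of_lt)
      (h.pairwise_lt.imp ne_of_lt)).2 fun p => ?_)
    rw [mem_Tsorted]
    simp only [hfeq]
    constructor
    · rintro ⟨i, rfl⟩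
      exact hfl i
    · intro hp
      have hi := Finset.mem_Icc.1 (h.mem_spec hp).1
      refine ⟨⟨(ofLex p).2 - 1, by omega⟩, h.eq_of_mem (hfl _) hp ?_⟩
      rw [hf]
      simp only
      omega

end Tsorted

section vortexList

variable {c : ℕ}

theorem vortexLe_total (x y : Fin c → ℕ) : vortexLe x y ∨ vortexLe y x := by
  by_cases h : x = y
  · exact .inl (.inr h)
  · exact (altB_total true (by simp only [length_Tsorted]) (Tsorted_injective.ne h)).imp .inl .inl

theorem vortexLe_trans {x y z : Fin c → ℕ} (h : vortexLe x y) (h' : vortexLe y z) :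
    vortexLe x z := by
  obtain h | rfl := h
  · obtain h' | rfl := h'
    · exact .inl (altB_trans h h')
    · exact .inl h
  · exact h'

theorem pairwise_vortexList (Ns : Fin c → ℕ) : (vortexList Ns).Pairwise vortexLe :=
  haveI : Std.Total (vortexLe (c := c)) := ⟨vortexLe_total⟩
  haveI : IsTrans _ (vortexLe (c := c)) := ⟨fun _ _ _ => vortexLe_trans⟩
  List.pairwise_insertionSort _ _

theorem mem_vortexList {Ns x : Fin c → ℕ} :
    x ∈ vortexList Ns ↔ ∀ i, x i ∈ Finset.Icc 1 (Ns i) := by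
  simp [vortexList]

theorem nodup_vortexList (Ns : Fin c → ℕ) : (vortexList Ns).Nodup :=
  (List.perm_insertionSort _ _).nodup_iff.2 (Finset.nodup_toList _)

/-- If every pair above a maximal pair is itself maximal, then the Vortex order is a Gray code. -/
theorem isGrayCode_vortexList {M : ℕ → ℕ}
    (hM : ∀ i j v, v ≤ M j → toLex (M i, i) < toLex (v, j) → v = M j) :
    IsGrayCode (vortexList fun i : Fin c => M (i.1 + 1)) := by
  refine List.isChain_iff_forall_rel_of_append_cons_cons.2 fun x y l₁ l₂ hl => ?_
  have hmem := fun z => (mem_vortexList (Ns := fun i : Fin c => M (i.1 + 1)) (x := z))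
  have hsort := pairwise_vortexList fun i : Fin c => M (i.1 + 1)
  have hnd := nodup_vortexList fun i : Fin c => M (i.1 + 1)
  rw [hl] at hmem hsort hnd
  have hxy : x ≠ y := by
    rintro rfl
    simp [List.nodup_append] at hnd
  simp only [List.pairwise_append, List.pairwise_cons] at hsort
  obtain ⟨-, ⟨hx, hy, -⟩, hl₁⟩ := hsort
  have hlt : vortexLt x y := (hx y (by simp)).resolve_right hxy
  have hle : ∀ {u v : Fin c → ℕ}, vortexLe u v → altB true (Tsorted v) (Tsorted u) = false := by
    rintro u v (h | rfl)
    · exact altB_asymm h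
    · by_contra h
      exact h (altB_asymm (by simpa using h))
  obtain ⟨i, hi⟩ := (isVortexTail_Tsorted ((hmem x).1 (by simp))).agree_of_consecutive hM
    (isVortexTail_Tsorted ((hmem y).1 (by simp))) hlt fun z hz hxz => by
      obtain ⟨w, hw, rfl⟩ := hz.exists_Tsorted_eq
      have hwl := (hmem w).2 hw
      simp only [List.mem_append, List.mem_cons] at hwl
      obtain h | rfl | rfl | h := hwl
      · rw [hle (hl₁ w h x (by simp))] at hxz
        simp at hxz
      · rw [hle (.inr rfl)] at hxz
        simp at hxz
      · exact hle (.inr rfl)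
      · exact hle (hy w h)
  refine le_antisymm ?_ (hammingDist_pos.2 hxy)
  refine Finset.card_le_one.2 ?_
  have key : ∀ j, x j ≠ y j → j.1 + 1 = i := fun j hj => by
    by_contra hne
    obtain ⟨k, hk⟩ := mem_Tsorted.1 ((hi (toLex (x j, j.1 + 1)) hne).1 (mem_Tsorted.2 ⟨j, rfl⟩))
    simp only [EmbeddingLike.apply_eq_iff_eq, Prod.mk.injEq, add_left_inj, Fin.val_inj] at hk
    obtain ⟨hk, rfl⟩ := hk
    exact hj hk.symm
  intro j hj k hk
  have h1 := key j (by simpa using hj)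
  have h2 := key k (by simpa using hk)
  exact Fin.ext (by omega)

theorem isGrayCode_Lam (c k N : ℕ) : IsGrayCode (Lam c k N) := by
  refine isGrayCode_vortexList (M := fun i => if i - 1 < c - k then N else N - 1)
    fun i j v hv h => ?_
  rw [Prod.Lex.lt_iff] at h
  simp only [ofLex_toLex] at h
  split_ifs at hv h ⊢ <;> omega

end vortexList

/-- If `Λ_{c-1,k-1}^N` and `Λ_{c,k}^N` are Gray codes (with `N > 1`, `c ≥ 2`,
`1 ≤ k ≤ c`), then so is `Λ_{c,k-1}^N`. -/
theorem stmt15 (N c k : ℕ) (hN : 1 < N) (hc : 2 ≤ c) (hk1 : 1 ≤ k) (hkc : k ≤ c)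
    (h1 : IsGrayCode (Lam (c - 1) (k - 1) N)) (h2 : IsGrayCode (Lam c k N)) :
    IsGrayCode (Lam c (k - 1) N) := by
  exact isGrayCode_Lam c (k - 1) N
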